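/- The lengths of all generalized zigzags in the n-simplex α_n and the cross-polytope β_n are n+1 and 2n respectively, equal to the Coxeter numbers h(A_n) = n+1 and h(B_n) = 2n. -/

import Mathlib

open scoped Classical

variable {V : Type*}

/-- `C` is a facet (maximal face) of a pure rank-`n` complex: a face with `n` vertices. -/
def IsFacet (n : ℕ) (faces : Finset V → Prop) (C : Finset V) : Prop :=
  faces C ∧ C.card = n

/-- `faces` describes a thin pure simplicial complex of rank `n` over the vertex set `V`:
it is downward closed, every singleton is a face, every face has at most `n` vertices and is
contained in a facet, and every ridge (face with `n - 1` vertices) lies in exactly two facets. -/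
def IsThinComplex (n : ℕ) (faces : Finset V → Prop) : Prop :=
  (∀ v : V, faces {v}) ∧
  (∀ ⦃X Y : Finset V⦄, faces X → Y ⊆ X → faces Y) ∧
  (∀ ⦃X : Finset V⦄, faces X → X.card ≤ n) ∧
  (∀ ⦃X : Finset V⦄, faces X → ∃ C : Finset V, IsFacet n faces C ∧ X ⊆ C) ∧
  (∀ ⦃R : Finset V⦄, faces R → R.card = n - 1 →
    {C : Finset V | IsFacet n faces C ∧ R ⊆ C}.ncard = 2)

/-- A flag, encoded by the ordered vertex sequence `x_0, …, x_{n-1}` determining it: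
the chain of faces is `{x_0} ⊂ {x_0,x_1} ⊂ … ⊂ {x_0,…,x_{n-1}}`, the top being a facet. -/
def IsFlag (n : ℕ) (faces : Finset V → Prop) (F : List V) : Prop :=
  F.length = n ∧ F.Nodup ∧ faces F.toFinset

/-- `G = T(F)` for the zigzag operator `T = σ_{n-1} ∘ ⋯ ∘ σ_0`: if `F` is determined by the
vertex sequence `x_0, x_1, …, x_{n-1}`, then `T(F)` is determined by `x_1, …, x_{n-1}, y` with
`y ≠ x_0`. -/
def TStep (n : ℕ) (faces : Finset V → Prop) (F G : List V) : Prop :=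
  IsFlag n faces F ∧ IsFlag n faces G ∧
    ∃ y : V, G = F.tail ++ [y] ∧ F.head? ≠ some y

/-- A zigzag of length `l`: the orbit `F, T F, T² F, …` of the operator `T` on flags, recorded
as the sequence `i ↦ Tⁱ F`; it is `l`-periodic with `l` the minimal period. -/
def IsZigzag (n : ℕ) (faces : Finset V → Prop) (l : ℕ) (F : ℕ → List V) : Prop :=
  0 < l ∧ (∀ i : ℕ, TStep n faces (F i) (F (i + 1))) ∧ (∀ i : ℕ, F (i + l) = F i) ∧
    ∀ m : ℕ, 0 < m → (∀ i : ℕ, F (i + m) = F i) → l ≤ m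

/-- The set of flags of a zigzag together with those of its reverse zigzag; two zigzags are
identified (a zigzag is identified with its reverse, and with its cyclic shifts) exactly when
these sets coincide. -/
def ZigzagClass (F : ℕ → List V) : Set (List V) :=
  Set.range F ∪ Set.range fun i => (F i).reverse

/-- `G = σ_i(F)`: the flag `G` has the same `j`-faces as `F` for all `j ≠ i`, and a different
`i`-face (the `j`-face of the flag with vertex sequence `F` is `(F.take (j+1)).toFinset`). -/
def SigmaStep (n : ℕ) (faces : Finset V → Prop) (i : ℕ) (F G : List V) : Prop :=
  IsFlag n faces F ∧ IsFlag n faces G ∧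
    (∀ j : ℕ, j < n → j ≠ i → (G.take (j + 1)).toFinset = (F.take (j + 1)).toFinset) ∧
    (G.take (i + 1)).toFinset ≠ (F.take (i + 1)).toFinset

/-- `G = T_δ(F)` where `T_δ = σ_{δ(n-1)} ∘ ⋯ ∘ σ_{δ(0)}`. -/
def TDeltaStep (n : ℕ) (faces : Finset V → Prop) (δ : Equiv.Perm (Fin n))
    (F G : List V) : Prop :=
  ∃ c : ℕ → List V, c 0 = F ∧ c n = G ∧
    ∀ i : Fin n, SigmaStep n faces (δ i) (c i) (c (i + 1))

/-- A generalized zigzag (δ-zigzag) of length `l`: the orbit of `T_δ` on flags. -/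
def IsGenZigzag (n : ℕ) (faces : Finset V → Prop) (δ : Equiv.Perm (Fin n)) (l : ℕ)
    (F : ℕ → List V) : Prop :=
  0 < l ∧ (∀ i : ℕ, TDeltaStep n faces δ (F i) (F (i + 1))) ∧ (∀ i : ℕ, F (i + l) = F i) ∧
    ∀ m : ℕ, 0 < m → (∀ i : ℕ, F (i + m) = F i) → l ≤ m

/-- Adjacency in the facet-adjacency graph `Γ_{n-1}(Δ)`: two distinct facets meeting in a ridge. -/
def FacetAdj (n : ℕ) (faces : Finset V → Prop) (C D : Finset V) : Prop :=
  IsFacet n faces C ∧ IsFacet n faces D ∧ C ≠ D ∧ (C ∩ D).card = n - 1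

/-- `p 0, p 1, …, p m` is a path in the facet-adjacency graph. -/
def IsFacetPath (n : ℕ) (faces : Finset V → Prop) (m : ℕ) (p : ℕ → Finset V) : Prop :=
  ∀ i : ℕ, i < m → FacetAdj n faces (p i) (p (i + 1))

/-- The path distance in the facet-adjacency graph `Γ_{n-1}(Δ)`. -/
noncomputable def facetDist (n : ℕ) (faces : Finset V → Prop) (X Y : Finset V) : ℕ :=
  sInf {m : ℕ | ∃ p : ℕ → Finset V, p 0 = X ∧ p m = Y ∧ IsFacetPath n faces m p}

/-- The complex is a chamber complex: the facet-adjacency graph is connected. -/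
def ChamberConnected (n : ℕ) (faces : Finset V → Prop) : Prop :=
  ∀ C D : Finset V, IsFacet n faces C → IsFacet n faces D →
    ∃ (m : ℕ) (p : ℕ → Finset V), p 0 = C ∧ p m = D ∧ IsFacetPath n faces m p

/-- Faces of the cross-polytope `β_n`: subsets of `{±1,…,±n}` (encoded as `Fin n × Bool`)
containing no antipodal pair. -/
def crossFaces (n : ℕ) (X : Finset (Fin n × Bool)) : Prop :=
  ∀ p ∈ X, (p.1, !p.2) ∉ X

/-- Partial products of the generators `s (δ 0) * s (δ 1) * ⋯`. -/
noncomputable def wprod {P : Type*} {n : ℕ} (s : Fin n → Equiv.Perm P)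
    (δ : Equiv.Perm (Fin n)) : ℕ → Equiv.Perm P
  | 0 => 1
  | k + 1 => wprod s δ k * (if h : k < n then s (δ ⟨k, h⟩) else 1)

/-- Functions invariant under a Coxeter element are invariant under all generators. -/
theorem inv_gen {P : Type*} {n : ℕ} (s : Fin n → Equiv.Perm P) (δ : Equiv.Perm (Fin n))
    (K : (P → ℚ) → Prop) (S : Fin n → (P → ℚ) → ℚ)
    (hK : ∀ h i, K h → K (h ∘ s i))
    (hS : ∀ h i j, K h → j ≠ i → S j (h ∘ s i) = S j h)
    (hfix : ∀ h i, K h → S i (h ∘ s i) = S i h → h ∘ s i = h)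
    (g : P → ℚ) (hg : K g) (hc : g ∘ wprod s δ n = g) (i : Fin n) : g ∘ s i = g := by
  have hsucc : ∀ k (hk : k < n),
      g ∘ wprod s δ (k + 1) = (g ∘ wprod s δ k) ∘ s (δ ⟨k, hk⟩) := by
    intro k hk
    ext x
    simp [wprod, hk]
  have hKk : ∀ k, k ≤ n → K (g ∘ wprod s δ k) := by
    intro k
    induction k with
    | zero => intro _; exact hg
    | succ k ih =>
      intro hk
      rw [hsucc k hk]
      exact hK _ _ (ih (by omega))
  have hlow : ∀ (j : Fin n) k, k ≤ (j : ℕ) →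
      S (δ j) (g ∘ wprod s δ k) = S (δ j) g := by
    intro j k
    induction k with
    | zero => intro _; rfl
    | succ k ih =>
      intro hk
      have hkn : k < n := by omega
      rw [hsucc k hkn, hS _ _ _ (hKk k hkn.le), ih (by omega)]
      intro h
      have := congrArg Fin.val (δ.injective h)
      simp at this
      omega
  have hhigh : ∀ (j : Fin n) d, (j : ℕ) + 1 + d ≤ n →
      S (δ j) (g ∘ wprod s δ (j + 1 + d)) = S (δ j) (g ∘ wprod s δ (j + 1)) := by
    intro j d
    induction d with
    | zero => intro _; rfl
    | succ d ih =>
      intro hd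
      have hkn : (j : ℕ) + 1 + d < n := by omega
      rw [← add_assoc, hsucc _ hkn, hS _ _ _ (hKk _ hkn.le), ih (by omega)]
      intro h
      have := congrArg Fin.val (δ.injective h)
      simp at this
      omega
  have hstep : ∀ k (hk : k < n), g ∘ wprod s δ (k + 1) = g ∘ wprod s δ k := by
    intro k hk
    rw [hsucc k hk]
    apply hfix _ _ (hKk k hk.le)
    rw [← hsucc k hk, hlow ⟨k, hk⟩ k le_rfl]
    have h1 := hhigh ⟨k, hk⟩ (n - (k + 1)) (by simp; omega)
    have h2 : k + 1 + (n - (k + 1)) = n := by omega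
    simp only [h2, hc] at h1
    exact h1.symm
  have hall : ∀ k, k ≤ n → g ∘ wprod s δ k = g := by
    intro k
    induction k with
    | zero => intro _; rfl
    | succ k ih => intro hk; rw [hstep k hk, ih (by omega)]
  obtain ⟨j, rfl⟩ := δ.surjective i
  have h1 := hsucc j j.2
  rw [hall _ j.2, hall _ j.2.le] at h1
  exact h1.symm

theorem core {P V : Type*} [Fintype P] [Nonempty P] (n : ℕ) (faces : Finset V → Prop)
    (δ : Equiv.Perm (Fin n)) (l : ℕ) (F : ℕ → List V)
    (Φ : (P → V) → List V) (Good : (P → V) → Prop) (s : Fin n → Equiv.Perm P)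
    (inj : ∀ e, Good e → Function.Injective e)
    (uniq : ∀ e e', Good e → Good e' → Φ e = Φ e' → e = e')
    (ex : ∀ F, IsFlag n faces F → ∃ e, Good e ∧ Φ e = F)
    (step : ∀ (i : Fin n) e e', Good e → Good e' → SigmaStep n faces i (Φ e) (Φ e') →
      e' = e ∘ s i)
    (const : ∀ g : P → ℚ, g ∘ wprod s δ n = g → ∀ x y, g x = g y)
    (hF : IsGenZigzag n faces δ l F) (hn : 1 ≤ n) : l = Fintype.card P := by
  obtain ⟨hl, hT, hper, hmin⟩ := hF
  set c := wprod s δ n with hcdef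
  have hflag0 : IsFlag n faces (F 0) := by
    obtain ⟨d, h0, -, hd⟩ := hT 0
    have := (hd ⟨0, hn⟩).1
    simpa [h0] using this
  have hone : ∀ e A B, Good e → Φ e = A → TDeltaStep n faces δ A B →
      Good (e ∘ c) ∧ Φ (e ∘ c) = B := by
    rintro e A B he hA ⟨d, h0, h1, hd⟩
    have key : ∀ k, k ≤ n → Good (e ∘ wprod s δ k) ∧ Φ (e ∘ wprod s δ k) = d k := by
      intro k
      induction k with
      | zero => intro _; exact ⟨he, by rw [h0, ← hA]; rfl⟩
      | succ k ih =>
        intro hk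
        obtain ⟨hg, hp⟩ := ih (by omega)
        have hs := hd ⟨k, hk⟩
        simp only at hs
        obtain ⟨e', he', hp'⟩ := ex _ hs.2.1
        rw [← hp, ← hp'] at hs
        have h2 := step _ _ _ hg he' hs
        have h3 : e ∘ wprod s δ (k + 1) = e' := by
          rw [h2]
          ext x
          have hk' : k < n := hk
          simp [wprod, hk']
        rw [h3]
        exact ⟨he', hp'⟩
    rw [← h1]
    exact key n le_rfl
  obtain ⟨e, he, hp⟩ := ex _ hflag0
  have hrep : ∀ m, Good (e ∘ (c ^ m : Equiv.Perm P)) ∧ Φ (e ∘ (c ^ m : Equiv.Perm P)) = F m := by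
    intro m
    induction m with
    | zero => exact ⟨he, hp⟩
    | succ m ih =>
      have h2 := hone _ _ _ ih.1 ih.2 (hT m)
      have h3 : e ∘ (c ^ (m + 1) : Equiv.Perm P) = (e ∘ (c ^ m : Equiv.Perm P)) ∘ c := by
        ext x; simp [pow_succ]
      rw [h3]; exact h2
  have hcyc : c.IsCycleOn ((Finset.univ : Finset P) : Set P) := by
    refine ⟨by simp [Set.bijOn_univ], ?_⟩
    intro x _ y _
    have h := const (fun z => if c.SameCycle x z then 1 else 0) (by
      ext z
      simp [Equiv.Perm.sameCycle_apply_right]) x y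
    by_contra hxy
    simp [hxy] at h
    exact h (Equiv.Perm.SameCycle.refl c x)
  obtain ⟨x0⟩ := (inferInstance : Nonempty P)
  apply le_antisymm
  · apply hmin _ Fintype.card_pos
    intro i
    rw [← (hrep (i + Fintype.card P)).2, ← (hrep i).2]
    congr 2
    rw [pow_add]
    have : c ^ Fintype.card P = 1 := by
      ext x
      have := (hcyc.pow_apply_eq (Finset.mem_univ x) (n := Fintype.card P)).2 (by simp)
      simpa using this
    rw [this, mul_one]
  · have h1 := hper 0
    rw [zero_add, ← (hrep l).2, ← hp] at h1
    have h2 := uniq _ _ (hrep l).1 he h1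
    have h3 : (c ^ l) x0 = x0 := inj e he (congrFun h2 x0)
    rw [hcyc.pow_apply_eq (Finset.mem_univ x0)] at h3
    exact Nat.le_of_dvd hl (by simpa using h3)

theorem mem_take_ofFn {V : Type*} {n : ℕ} (a : Fin n → V) (j : ℕ) (v : V) :
    v ∈ ((List.ofFn a).take (j + 1)).toFinset ↔ ∃ x : Fin n, (x : ℕ) ≤ j ∧ a x = v := by
  rw [List.mem_toFinset, List.mem_take_iff_getElem]
  constructor
  · rintro ⟨i, hi, rfl⟩
    have : i < n := by simp at hi; omega
    exact ⟨⟨i, this⟩, by simp at hi; simp; omega, by simp⟩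
  · rintro ⟨x, hx, rfl⟩
    exact ⟨x, by simp; omega, by simp⟩

theorem sigma_fn {V : Type*} {n : ℕ} {faces : Finset V → Prop} (i : Fin n) (a b : Fin n → V)
    (h : SigmaStep n faces i (List.ofFn a) (List.ofFn b)) :
    (∀ x : Fin n, x ≠ i → (x : ℕ) ≠ i + 1 → b x = a x) ∧
    (∀ x : Fin n, (x : ℕ) = i + 1 → b i = a x ∧ b x = a i) ∧
    ((i : ℕ) + 1 = n → ∀ y, b i ≠ a y) := by
  obtain ⟨⟨-, ha, -⟩, ⟨-, hb, -⟩, hj, hne⟩ := h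
  rw [List.nodup_ofFn] at ha hb
  have hj' : ∀ j : ℕ, j < n → j ≠ i → ∀ v,
      (∃ x : Fin n, (x : ℕ) ≤ j ∧ b x = v) ↔ (∃ x : Fin n, (x : ℕ) ≤ j ∧ a x = v) := by
    intro j h1 h2 v
    rw [← mem_take_ofFn, ← mem_take_ofFn, hj j h1 h2]
  have h1 : ∀ x : Fin n, x ≠ i → (x : ℕ) ≠ i + 1 → b x = a x := by
    intro x hx hx'
    have hxi : (x : ℕ) ≠ i := fun h => hx (Fin.ext h)
    obtain ⟨y, hy, hyx⟩ := (hj' x x.2 hxi (b x)).1 ⟨x, le_rfl, rfl⟩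
    rcases hy.eq_or_lt with h | h
    · rw [← hyx, Fin.ext h]
    · obtain ⟨z, hz, hzy⟩ := (hj' (x - 1) (by omega) (by omega) (a y)).2 ⟨y, by omega, rfl⟩
      have := hb (hzy.trans hyx)
      subst this
      omega
  have hni : b i ≠ a i := by
    intro hbi
    apply hne
    ext v
    rw [mem_take_ofFn, mem_take_ofFn]
    have : ∀ x : Fin n, (x : ℕ) ≤ i → b x = a x := by
      intro x hx
      by_cases hxi : x = i
      · rw [hxi, hbi]
      · exact h1 x hxi (by omega)
    constructor
    · rintro ⟨x, hx, rfl⟩; exact ⟨x, hx, (this x hx).symm⟩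
    · rintro ⟨x, hx, rfl⟩; exact ⟨x, hx, this x hx⟩
  have hlt : ∀ (x y : Fin n), y < i → i ≤ x → b x ≠ a y := by
    intro x y hy hx h
    rw [← h1 y hy.ne (by have : (y : ℕ) < i := hy
                         omega)] at h
    have := hb h
    subst this
    exact absurd hy (not_lt.2 hx)
  refine ⟨h1, ?_, ?_⟩
  · intro x hx
    have hix : i ≤ x := by rw [Fin.le_def]; omega
    have hbi : b i = a x := by
      obtain ⟨y, hy, hyx⟩ := (hj' x x.2 (by omega) (b i)).1 ⟨i, hix, rfl⟩
      rcases lt_trichotomy y i with h | h | h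
      · exact absurd hyx.symm (hlt i y h le_rfl)
      · subst h; exact absurd hyx.symm hni
      · have : y = x := by
          apply Fin.ext
          have : (i : ℕ) < y := h
          omega
        rw [← hyx, this]
    refine ⟨hbi, ?_⟩
    obtain ⟨y, hy, hyx⟩ := (hj' x x.2 (by omega) (b x)).1 ⟨x, le_rfl, rfl⟩
    rcases lt_trichotomy y i with h | h | h
    · exact absurd hyx.symm (hlt x y h hix)
    · subst h; exact hyx.symm
    · have : y = x := by
        apply Fin.ext
        have : (i : ℕ) < y := h
        omega
      subst this
      have := hb (hbi.trans hyx)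
      subst this
      omega
  · intro hin y h
    rcases lt_trichotomy y i with h' | h' | h'
    · exact hlt i y h' le_rfl h
    · subst h'; exact hni h
    · have : (i : ℕ) < y := h'
      omega

/-- Generators of type `A_n`. -/
noncomputable def sA (n : ℕ) (i : Fin n) : Equiv.Perm (Fin (n + 1)) :=
  Equiv.swap i.castSucc i.succ

theorem partial_sum_swap {N : ℕ} (h : Fin N → ℚ) (j : ℕ) (a b : Fin N) (hab : (b : ℕ) = a + 1)
    (hj : j ≠ a) :
    ∑ x ∈ Finset.univ.filter (fun x : Fin N => (x : ℕ) ≤ j), h (Equiv.swap a b x) =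
    ∑ x ∈ Finset.univ.filter (fun x : Fin N => (x : ℕ) ≤ j), h x := by
  refine Finset.sum_equiv (Equiv.swap a b) ?_ (fun _ _ => rfl)
  intro x
  simp only [Finset.mem_filter, Finset.mem_univ, true_and]
  rcases eq_or_ne x a with rfl | hxa
  · simp; omega
  · rcases eq_or_ne x b with rfl | hxb
    · simp; omega
    · rw [Equiv.swap_apply_of_ne_of_ne hxa hxb]

theorem partial_sum_last {N : ℕ} (h : Fin N → ℚ) (i : Fin N) :
    ∑ x ∈ Finset.univ.filter (fun x : Fin N => (x : ℕ) ≤ i), h x =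
    h i + ∑ x ∈ Finset.univ.filter (fun x : Fin N => (x : ℕ) < i), h x := by
  have : Finset.univ.filter (fun x : Fin N => (x : ℕ) ≤ i) =
      insert i (Finset.univ.filter (fun x : Fin N => (x : ℕ) < i)) := by
    ext x
    simp only [Finset.mem_filter, Finset.mem_univ, true_and, Finset.mem_insert, Fin.ext_iff]
    omega
  rw [this, Finset.sum_insert (by simp)]

theorem partial_sum_swap_eq {N : ℕ} (h : Fin N → ℚ) (a b : Fin N) (hab : (b : ℕ) = a + 1)
    (hs : ∑ x ∈ Finset.univ.filter (fun x : Fin N => (x : ℕ) ≤ a), h (Equiv.swap a b x) =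
    ∑ x ∈ Finset.univ.filter (fun x : Fin N => (x : ℕ) ≤ a), h x) : h b = h a := by
  rw [partial_sum_last (fun x => h (Equiv.swap a b x)), partial_sum_last h] at hs
  have : ∑ x ∈ Finset.univ.filter (fun x : Fin N => (x : ℕ) < a), h (Equiv.swap a b x) =
      ∑ x ∈ Finset.univ.filter (fun x : Fin N => (x : ℕ) < a), h x := by
    apply Finset.sum_congr rfl
    intro x hx
    simp only [Finset.mem_filter, Finset.mem_univ, true_and] at hx
    rw [Equiv.swap_apply_of_ne_of_ne] <;> · rintro rfl; omega
  rw [this] at hs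
  simpa using hs

theorem comp_swap_eq {P : Type*} [DecidableEq P] (h : P → ℚ) (a b : P) (hab : h b = h a) (x : P) :
    h (Equiv.swap a b x) = h x := by
  rcases eq_or_ne x a with rfl | hxa
  · simp [hab]
  · rcases eq_or_ne x b with rfl | hxb
    · simp [hab]
    · rw [Equiv.swap_apply_of_ne_of_ne hxa hxb]

theorem constA (n : ℕ) (δ : Equiv.Perm (Fin n)) (g : Fin (n + 1) → ℚ)
    (hg : g ∘ wprod (sA n) δ n = g) (x y : Fin (n + 1)) : g x = g y := by
  have hinv := inv_gen (sA n) δ (fun _ => True)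
    (fun j h => ∑ x ∈ Finset.univ.filter (fun x : Fin (n + 1) => (x : ℕ) ≤ j), h x)
    (fun _ _ _ => trivial)
    (fun h i j _ hij => partial_sum_swap h j _ _ (by simp) (by
      simpa [Fin.ext_iff] using hij))
    (fun h i _ hs => by
      have := partial_sum_swap_eq h i.castSucc i.succ (by simp) hs
      ext x
      exact comp_swap_eq h _ _ this x) g trivial hg
  have h0 : ∀ x, g x = g 0 := by
    intro x
    induction x using Fin.induction with
    | zero => rfl
    | succ i ih =>
      rw [← ih]
      have := congrFun (hinv i) i.castSucc
      simpa [sA] using this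
  rw [h0 x, h0 y]

theorem uniqA (n : ℕ) (e e' : Fin (n + 1) → Fin (n + 1)) (he : Function.Injective e)
    (he' : Function.Injective e') (h : ∀ x : Fin n, e x.castSucc = e' x.castSucc) : e = e' := by
  have hl : e (Fin.last n) = e' (Fin.last n) := by
    obtain ⟨y, hy⟩ := (Finite.injective_iff_surjective.1 he') (e (Fin.last n))
    induction y using Fin.lastCases with
    | last => exact hy.symm
    | cast y =>
      rw [← h] at hy
      exact absurd (he hy) (Fin.castSucc_lt_last y).ne
  ext x
  induction x using Fin.lastCases with
  | last => rw [hl]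
  | cast y => rw [h]

theorem partA (n : ℕ) (hn : 1 ≤ n) (δ : Equiv.Perm (Fin n)) (l : ℕ) (F : ℕ → List (Fin (n + 1)))
    (hF : IsGenZigzag n (fun X : Finset (Fin (n + 1)) => X ≠ Finset.univ) δ l F) :
    l = n + 1 := by
  have := core (P := Fin (n + 1)) n _ δ l F (fun e => List.ofFn (fun x : Fin n => e x.castSucc))
    Function.Injective (sA n) (fun _ h => h) ?_ ?_ ?_ (constA n δ) hF hn
  · simpa using this
  · intro e e' he he' h
    exact uniqA n e e' he he' (congrFun (List.ofFn_injective h))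
  · rintro A ⟨hlen, hnd, hf⟩
    obtain ⟨a, rfl⟩ : ∃ a : Fin n → Fin (n + 1), List.ofFn a = A :=
      ⟨fun i => A.get (i.cast hlen.symm), List.ext_getElem (by simp [hlen]) (by simp)⟩
    rw [List.nodup_ofFn] at hnd
    have : ∃ y, ∀ x, a x ≠ y := by
      by_contra hcon
      push Not at hcon
      exact hf (by ext y; simpa [List.mem_ofFn] using hcon y)
    obtain ⟨y, hy⟩ := this
    refine ⟨Fin.snoc (α := fun _ => Fin (n + 1)) a y, ?_, by simp⟩
    rw [Fin.snoc_injective_iff]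
    exact ⟨hnd, by simpa [Set.mem_range] using hy⟩
  · intro i e e' he he' hs
    obtain ⟨h1, h2, h3⟩ := sigma_fn i _ _ hs
    apply uniqA n _ _ he' (he.comp (sA n i).injective)
    intro x
    simp only [Function.comp, sA]
    by_cases hxi : x = i
    · subst hxi
      rw [Equiv.swap_apply_left]
      by_cases hx : (x : ℕ) + 1 < n
      · rw [(h2 ⟨x + 1, hx⟩ rfl).1]; rfl
      · have hx' : (x : ℕ) + 1 = n := by omega
        obtain ⟨y, hy⟩ := (Finite.injective_iff_surjective.1 he) (e' x.castSucc)
        induction y using Fin.lastCases with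
        | last =>
          rw [← hy]; congr 1; ext; simp [hx']
        | cast y => exact absurd hy.symm (h3 hx' y)
    · by_cases hx : (x : ℕ) = i + 1
      · have : x.castSucc = i.succ := by ext; simpa using hx
        rw [this, Equiv.swap_apply_right, ← this]
        exact (h2 x hx).2
      · rw [Equiv.swap_apply_of_ne_of_ne, h1 x hxi hx]
        · simpa using hxi
        · intro h; apply hx; simpa [Fin.ext_iff] using h

/-- Underlying map of the generators of type `B_n`. -/
noncomputable def sBfun (n : ℕ) (i : Fin n) (p : Fin n × Bool) : Fin n × Bool :=
  if h : (i : ℕ) + 1 < n then (Equiv.swap i ⟨i + 1, h⟩ p.1, p.2)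
  else if p.1 = i then (p.1, !p.2) else p

theorem sBfun_invol (n : ℕ) (i : Fin n) : Function.Involutive (sBfun n i) := by
  rintro ⟨x, b⟩
  unfold sBfun
  split_ifs <;> simp_all

/-- Generators of type `B_n`. -/
noncomputable def sB (n : ℕ) (i : Fin n) : Equiv.Perm (Fin n × Bool) :=
  (sBfun_invol n i).toPerm

theorem sB_lt (n : ℕ) (i : Fin n) (h : (i : ℕ) + 1 < n) (x : Fin n) (b : Bool) :
    sB n i (x, b) = (Equiv.swap i ⟨i + 1, h⟩ x, b) := by
  simp [sB, sBfun, h]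

theorem sB_last (n : ℕ) (i : Fin n) (h : ¬ (i : ℕ) + 1 < n) (b : Bool) :
    sB n i (i, b) = (i, !b) := by
  simp [sB, sBfun, h]

theorem sB_last_ne (n : ℕ) (i : Fin n) (h : ¬ (i : ℕ) + 1 < n) (x : Fin n) (hx : x ≠ i)
    (b : Bool) : sB n i (x, b) = (x, b) := by
  simp [sB, sBfun, h, hx]

theorem sB_neg (n : ℕ) (i x : Fin n) (b : Bool) :
    sB n i (x, !b) = ((sB n i (x, b)).1, !(sB n i (x, b)).2) := by
  simp only [sB, sBfun, Function.Involutive.coe_toPerm]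
  split_ifs <;> simp

theorem invB (n : ℕ) (δ : Equiv.Perm (Fin n)) (ε : ℚ) (g : Fin n × Bool → ℚ)
    (hε : ∀ x b, g (x, !b) = ε * g (x, b)) (hg : g ∘ wprod (sB n) δ n = g) (i : Fin n) :
    g ∘ sB n i = g := by
  refine inv_gen (sB n) δ (fun h => ∀ x b, h (x, !b) = ε * h (x, b))
    (fun j h => ∑ x ∈ Finset.univ.filter (fun x : Fin n => (x : ℕ) ≤ j), h (x, true))
    ?_ ?_ ?_ g hε hg i
  · intro h i hh x b
    simp only [Function.comp]
    rw [sB_neg, hh]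
  · intro h i j _ hij
    by_cases hi : (i : ℕ) + 1 < n
    · simp only [Function.comp, sB_lt n i hi]
      exact partial_sum_swap (fun x => h (x, true)) j i _ rfl (by simpa [Fin.ext_iff] using hij)
    · apply Finset.sum_congr rfl
      intro x hx
      simp only [Finset.mem_filter, Finset.mem_univ, true_and] at hx
      simp only [Function.comp]
      rw [sB_last_ne n i hi]
      rintro rfl
      have : (j : ℕ) ≠ x := fun h => hij (Fin.ext h)
      omega
  · intro h i hh hs
    have htrue : ∀ x, (h ∘ sB n i) (x, true) = h (x, true) := by
      by_cases hi : (i : ℕ) + 1 < n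
      · simp only [Function.comp, sB_lt n i hi] at hs ⊢
        have := partial_sum_swap_eq (fun x => h (x, true)) i _ rfl hs
        intro x
        exact comp_swap_eq (fun x => h (x, true)) _ _ this x
      · intro x
        by_cases hx : x = i
        · subst hx
          rw [partial_sum_last (fun y => (h ∘ sB n x) (y, true)),
            partial_sum_last (fun y => h (y, true))] at hs
          have : ∑ y ∈ Finset.univ.filter (fun y : Fin n => (y : ℕ) < x), (h ∘ sB n x) (y, true) =
              ∑ y ∈ Finset.univ.filter (fun y : Fin n => (y : ℕ) < x), h (y, true) := by
            apply Finset.sum_congr rfl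
            intro y hy
            simp only [Finset.mem_filter, Finset.mem_univ, true_and] at hy
            simp only [Function.comp]
            rw [sB_last_ne n x hi]
            rintro rfl
            omega
          rw [this] at hs
          exact add_right_cancel hs
        · simp only [Function.comp]
          rw [sB_last_ne n i hi x hx]
    ext ⟨x, b⟩
    cases b with
    | true => exact htrue x
    | false =>
      have h1 := hh x true
      have h2 : (h ∘ sB n i) (x, !true) = ε * (h ∘ sB n i) (x, true) := by
        simp only [Function.comp]
        rw [sB_neg, hh]
      rw [htrue, ← h1] at h2
      exact h2

theorem wprodB_neg (n : ℕ) (δ : Equiv.Perm (Fin n)) (k : ℕ) : ∀ (x : Fin n) (b : Bool),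
    wprod (sB n) δ k (x, !b) =
      ((wprod (sB n) δ k (x, b)).1, !(wprod (sB n) δ k (x, b)).2) := by
  induction k with
  | zero => intro x b; rfl
  | succ k ih =>
    intro x b
    by_cases h : k < n
    · simp only [wprod, h, dite_true, Equiv.Perm.mul_apply]
      rw [sB_neg, ih]
    · simp only [wprod, h, dite_false, mul_one]
      exact ih x b

theorem constB (n : ℕ) (δ : Equiv.Perm (Fin n)) (g : Fin n × Bool → ℚ)
    (hg : g ∘ wprod (sB n) δ n = g) (p q : Fin n × Bool) : g p = g q := by
  have hg1 : ∀ x b, g (wprod (sB n) δ n (x, b)) = g (x, b) := fun x b => congrFun hg (x, b)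
  have hg2 : ∀ x b, g ((wprod (sB n) δ n (x, b)).1, !(wprod (sB n) δ n (x, b)).2)
      = g (x, !b) := by
    intro x b
    rw [← wprodB_neg]
    exact hg1 x _
  have hinv : ∀ i p, g (sB n i p) = g p := by
    intro i p
    have he := congrFun (invB n δ 1 (fun p => g p + g (p.1, !p.2)) (by
      intro x b; simp; ring) (by
      ext ⟨x, b⟩
      simp only [Function.comp]
      rw [hg1, hg2]) i) p
    have ho := congrFun (invB n δ (-1) (fun p => g p - g (p.1, !p.2)) (by
      intro x b; simp) (by
      ext ⟨x, b⟩
      simp only [Function.comp]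
      rw [hg1, hg2]) i) p
    simp only [Function.comp] at he ho
    linarith
  have hn : 0 < n := p.1.pos
  have key : ∀ d (x : Fin n) b, (x : ℕ) + d + 1 = n →
      g (x, b) = g (⟨n - 1, by omega⟩, true) := by
    intro d
    induction d with
    | zero =>
      intro x b hx
      have hx' : x = ⟨n - 1, by omega⟩ := Fin.ext (by simp; omega)
      rw [← hx']
      cases b with
      | true => rfl
      | false =>
        have := hinv x (x, true)
        rw [sB_last n x (by omega)] at this
        exact this
    | succ d ih =>
      intro x b hx
      have hlt : (x : ℕ) + 1 < n := by omega
      have := hinv x (x, b)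
      rw [sB_lt n x hlt, Equiv.swap_apply_left] at this
      rw [← this]
      exact ih _ b (by simp; omega)
  rw [show p = (p.1, p.2) from rfl, show q = (q.1, q.2) from rfl,
    key (n - 1 - p.1) p.1 p.2 (by omega), key (n - 1 - q.1) q.1 q.2 (by omega)]

theorem partB (n : ℕ) (hn : 1 ≤ n) (δ : Equiv.Perm (Fin n)) (l : ℕ) (F : ℕ → List (Fin n × Bool))
    (hF : IsGenZigzag n (crossFaces n) δ l F) : l = 2 * n := by
  have : Nonempty (Fin n) := ⟨⟨0, hn⟩⟩
  have uniqB : ∀ e e' : Fin n × Bool → Fin n × Bool,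
      (∀ x b, e (x, !b) = ((e (x, b)).1, !(e (x, b)).2)) →
      (∀ x b, e' (x, !b) = ((e' (x, b)).1, !(e' (x, b)).2)) →
      (∀ x, e (x, true) = e' (x, true)) → e = e' := by
    intro e e' he he' h
    funext ⟨x, b⟩
    cases b with
    | true => exact h x
    | false =>
      have h1 := he x true
      have h2 := he' x true
      rw [h, ← h2] at h1
      exact h1
  have := core (P := Fin n × Bool) n _ δ l F (fun e => List.ofFn (fun x : Fin n => e (x, true)))
    (fun e => Function.Injective e ∧ ∀ x b, e (x, !b) = ((e (x, b)).1, !(e (x, b)).2))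
    (sB n) (fun _ h => h.1) ?_ ?_ ?_ (constB n δ) hF hn
  · simpa [mul_comm] using this
  · intro e e' he he' h
    exact uniqB e e' he.2 he'.2 (congrFun (List.ofFn_injective h))
  · rintro A ⟨hlen, hnd, hf⟩
    obtain ⟨a, rfl⟩ : ∃ a : Fin n → Fin n × Bool, List.ofFn a = A :=
      ⟨fun i => A.get (i.cast hlen.symm), List.ext_getElem (by simp [hlen]) (by simp)⟩
    rw [List.nodup_ofFn] at hnd
    have hinj := hnd
    have hf' : ∀ x y : Fin n, a y ≠ ((a x).1, !(a x).2) := by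
      intro x y h
      apply hf (a x) (by simp)
      rw [← h]
      simp
    refine ⟨fun p => if p.2 then a p.1 else ((a p.1).1, !(a p.1).2), ⟨?_, ?_⟩, by simp⟩
    · rintro ⟨x, b⟩ ⟨y, b'⟩ h
      cases b <;> cases b'
      · have : a x = a y := by
          simp only [Bool.false_eq_true, if_false, Prod.mk.injEq, Bool.not_inj_iff] at h
          exact Prod.ext h.1 h.2
        rw [hinj this]
      · exact absurd h.symm (by simpa using hf' x y)
      · exact absurd h (by simpa using hf' y x)
      · have h' : a x = a y := by simpa using h
        rw [hinj h']
    · intro x b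
      cases b <;> simp
  · intro i e e' he he' hs
    obtain ⟨h1, h2, h3⟩ := sigma_fn i _ _ hs
    apply uniqB _ _ he'.2
    · intro x b
      simp only [Function.comp]
      rw [sB_neg, he.2]
    intro x
    simp only [Function.comp]
    by_cases hi : (i : ℕ) + 1 < n
    · rw [sB_lt n i hi]
      by_cases hxi : x = i
      · subst hxi
        rw [Equiv.swap_apply_left, (h2 ⟨x + 1, hi⟩ rfl).1]
      · by_cases hx : (x : ℕ) = i + 1
        · have : x = ⟨i + 1, hi⟩ := Fin.ext hx
          rw [← this, Equiv.swap_apply_right]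
          exact (h2 x hx).2
        · rw [Equiv.swap_apply_of_ne_of_ne hxi (by intro h; apply hx; rw [h]), h1 x hxi hx]
    · by_cases hxi : x = i
      · subst hxi
        rw [sB_last n x hi]
        obtain ⟨⟨y, b⟩, hy⟩ := (Finite.injective_iff_surjective.1 he.1) (e' (x, true))
        cases b with
        | true => exact absurd hy.symm (h3 (by omega) y)
        | false =>
          by_cases hyx : y = x
          · rw [← hy, hyx]; rfl
          · have h4 := h1 y hyx (by omega)
            have h5 := he.2 y true
            have h6 := he'.2 y true
            rw [← h4, ← h6] at h5
            have := he'.1 (hy.symm.trans h5)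
            simp at this
      · rw [sB_last_ne n i hi x hxi]
        exact h1 x hxi (by omega)

/-- All generalized zigzags in the `n`-simplex `α_n` have length `n + 1 = h(A_n)`
and all generalized zigzags in the cross-polytope `β_n` have length `2n = h(B_n)`. -/
theorem stmt15 (n : ℕ) (hn : 1 ≤ n) :
    (∀ (δ : Equiv.Perm (Fin n)) (l : ℕ) (F : ℕ → List (Fin (n + 1))),
      IsGenZigzag n (fun X : Finset (Fin (n + 1)) => X ≠ Finset.univ) δ l F → l = n + 1) ∧
    (∀ (δ : Equiv.Perm (Fin n)) (l : ℕ) (F : ℕ → List (Fin n × Bool)),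
      IsGenZigzag n (crossFaces n) δ l F → l = 2 * n) := by
  exact ⟨partA n hn, partB n hn⟩
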